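/- Let p and q be prime numbers with p ≡ 5 (mod 8), q ≡ 3 (mod 8), and Legendre symbol (p/q) = −1. Let K = ℚ(√p, √q), and let ε_p, ε_q, ε_{pq} denote the images in the ring of integers of K of the fundamental units (greater than 1 under a real embedding with √p, √q > 0) of ℚ(√p), ℚ(√q), ℚ(√(pq)) respectively. Then the product ε_q·ε_{pq} is a square in the ring of integers of K, and for any unit u with u² = ε_q·ε_{pq}, the unit group of the ring of integers of K is generated by −1, ε_p, ε_q and u; that is, {ε_p, ε_q, √(ε_q ε_{pq})} is a fundamental system of units of K. -/

import Mathlib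

/-- The real quadratic field `ℚ(√d)` as a subfield of `ℝ`. -/
noncomputable def QF (d : ℕ) : IntermediateField ℚ ℝ :=
  IntermediateField.adjoin ℚ {Real.sqrt d}

/-- The real value (under the inclusion in `ℝ`, where all square roots are
positive) of a unit of the ring of integers of a subfield `K` of `ℝ`. -/
noncomputable def uval {K : IntermediateField ℚ ℝ}
    (u : (integralClosure ℤ K)ˣ) : ℝ :=
  (((u : integralClosure ℤ K) : K) : ℝ)

/-- `t` is (the real value of) the fundamental unit of `ℚ(√d)`: a unit of the
ring of integers which is `> 1` and which generates the full unit group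
together with `-1`. -/
def IsFundUnit (d : ℕ) (t : ℝ) : Prop :=
  ∃ ε : (integralClosure ℤ (QF d))ˣ,
    uval ε = t ∧ 1 < t ∧
    ∀ u : (integralClosure ℤ (QF d))ˣ, ∃ n : ℤ, u = ε ^ n ∨ u = -(ε ^ n)

/-- The real multiquadratic field `ℚ(√a, √b)` as a subfield of `ℝ`. -/
noncomputable def K2 (a b : ℕ) : IntermediateField ℚ ℝ :=
  IntermediateField.adjoin ℚ {Real.sqrt a, Real.sqrt b}

lemma uval_mul {K : IntermediateField ℚ ℝ} (u v : (integralClosure ℤ K)ˣ) :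
    uval (u * v) = uval u * uval v := by
  simp [uval]

lemma uval_one {K : IntermediateField ℚ ℝ} : uval (1 : (integralClosure ℤ K)ˣ) = 1 := by
  simp [uval]

lemma uval_neg {K : IntermediateField ℚ ℝ} (u : (integralClosure ℤ K)ˣ) :
    uval (-u) = -uval u := by
  simp [uval]

lemma uval_injective {K : IntermediateField ℚ ℝ} :
    Function.Injective (uval : (integralClosure ℤ K)ˣ → ℝ) := fun _ _ h =>
  Units.ext (Subtype.ext (Subtype.ext h))

lemma uval_ne_zero {K : IntermediateField ℚ ℝ} (u : (integralClosure ℤ K)ˣ) : uval u ≠ 0 := by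
  intro h
  have := uval_mul u u⁻¹
  rw [mul_inv_cancel, uval_one, h, zero_mul] at this
  exact one_ne_zero this

lemma uval_inv {K : IntermediateField ℚ ℝ} (u : (integralClosure ℤ K)ˣ) :
    uval u⁻¹ = (uval u)⁻¹ := by
  refine eq_inv_of_mul_eq_one_left ?_
  rw [← uval_mul, inv_mul_cancel, uval_one]

lemma uval_zpow {K : IntermediateField ℚ ℝ} (u : (integralClosure ℤ K)ˣ) (n : ℤ) :
    uval (u ^ n) = uval u ^ n := by
  have hnat (n : ℕ) : uval (u ^ n) = uval u ^ n := by simp [uval]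
  obtain ⟨n, rfl | rfl⟩ := n.eq_nat_or_neg
  · simpa using hnat n
  · simp [uval_inv, hnat]

/-- `x` is the real value of a unit of the ring of integers of `K`. -/
def IsUnitValue (K : IntermediateField ℚ ℝ) (x : ℝ) : Prop :=
  ∃ u : (integralClosure ℤ K)ˣ, uval u = x

lemma isUnitValue_iff {K : IntermediateField ℚ ℝ} {x : ℝ} :
    IsUnitValue K x ↔ x ∈ K ∧ x ≠ 0 ∧ IsIntegral ℤ x ∧ IsIntegral ℤ x⁻¹ := by
  have hint (u : (integralClosure ℤ K)ˣ) : IsIntegral ℤ (uval u) :=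
    (u : integralClosure ℤ K).2.map (K.val.restrictScalars ℤ)
  have hdown {y : ℝ} (hy : y ∈ K) (h : IsIntegral ℤ y) : IsIntegral ℤ (⟨y, hy⟩ : K) :=
    (isIntegral_algHom_iff (K.val.restrictScalars ℤ) K.val.injective).1 h
  constructor
  · rintro ⟨u, rfl⟩
    exact ⟨((u : integralClosure ℤ K) : K).2, uval_ne_zero u, hint u, uval_inv u ▸ hint u⁻¹⟩
  · rintro ⟨hx, hx0, hi, hi'⟩
    refine ⟨⟨⟨⟨x, hx⟩, hdown hx hi⟩, ⟨⟨x⁻¹, inv_mem hx⟩, hdown _ hi'⟩, ?_, ?_⟩, rfl⟩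
    · exact Subtype.ext (Subtype.ext (mul_inv_cancel₀ hx0))
    · exact Subtype.ext (Subtype.ext (inv_mul_cancel₀ hx0))

lemma IsUnitValue.mono {K L : IntermediateField ℚ ℝ} (h : K ≤ L) {x : ℝ}
    (hx : IsUnitValue K x) : IsUnitValue L x := by
  rw [isUnitValue_iff] at hx ⊢
  exact ⟨h hx.1, hx.2⟩

/-- A ring homomorphism sends unit values to units among the algebraic integers. -/
lemma IsUnitValue.map {K : IntermediateField ℚ ℝ} {x : K} (hx : IsUnitValue K (x : ℝ))
    (σ : K →+* ℝ) : σ x ≠ 0 ∧ IsIntegral ℤ (σ x) ∧ IsIntegral ℤ (σ x)⁻¹ := by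
  obtain ⟨u, hu⟩ := hx
  have hux : ((u : integralClosure ℤ K) : K) = x := Subtype.ext hu
  have hinv : ((u⁻¹ : (integralClosure ℤ K)ˣ) : integralClosure ℤ K) = x⁻¹ := by
    exact Subtype.ext ((uval_inv u).trans (by simp [hu]))
  refine ⟨?_, ?_, ?_⟩
  · rw [map_ne_zero, ← hux]
    intro h
    exact uval_ne_zero u (by simp [uval, h])
  · rw [← hux]
    exact (u : integralClosure ℤ K).2.map σ.toIntAlgHom
  · rw [← map_inv₀, ← hinv]
    exact ((u⁻¹ : (integralClosure ℤ K)ˣ) : integralClosure ℤ K).2.map σ.toIntAlgHom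

/-- Uniqueness of coordinates with respect to `1, α` when `α` lies outside `F`. -/
lemma coords_unique {F : IntermediateField ℚ ℝ} {α : ℝ} (hα : α ∉ F) {a b c d : ℝ}
    (ha : a ∈ F) (hb : b ∈ F) (hc : c ∈ F) (hd : d ∈ F) (h : a + b * α = c + d * α) :
    a = c ∧ b = d := by
  have hbd : b = d := by
    by_contra hne
    have hne' : b - d ≠ 0 := sub_ne_zero.2 hne
    refine hα ?_
    have : α = (c - a) / (b - d) := by field_simp; linarith
    rw [this]
    exact div_mem (sub_mem hc ha) (sub_mem hb hd)
  subst hbd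
  exact ⟨by linarith, rfl⟩

lemma exists_coords_of_mem_adjoin {F : IntermediateField ℚ ℝ} {α : ℝ} (hα : α ∉ F)
    (hα2 : α ^ 2 ∈ F) {S : Set ℝ} (hS : ∀ s ∈ S, ∃ a ∈ F, ∃ b ∈ F, s = a + b * α) {x : ℝ}
    (hx : x ∈ IntermediateField.adjoin ℚ S) : ∃ a ∈ F, ∃ b ∈ F, x = a + b * α := by
  induction hx using IntermediateField.adjoin_induction with
  | mem s hs => exact hS s hs
  | algebraMap r => exact ⟨_, F.algebraMap_mem r, 0, zero_mem F, by simp⟩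
  | add x y _ _ hx hy =>
    obtain ⟨a, ha, b, hb, rfl⟩ := hx
    obtain ⟨c, hc, d, hd, rfl⟩ := hy
    exact ⟨a + c, add_mem ha hc, b + d, add_mem hb hd, by ring⟩
  | mul x y _ _ hx hy =>
    obtain ⟨a, ha, b, hb, rfl⟩ := hx
    obtain ⟨c, hc, d, hd, rfl⟩ := hy
    exact ⟨a * c + b * d * α ^ 2, add_mem (mul_mem ha hc) (mul_mem (mul_mem hb hd) hα2),
      a * d + b * c, add_mem (mul_mem ha hd) (mul_mem hb hc), by ring⟩
  | inv x _ hx =>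
    obtain ⟨a, ha, b, hb, rfl⟩ := hx
    by_cases h0 : a + b * α = 0
    · exact ⟨0, zero_mem F, 0, zero_mem F, by simp [h0]⟩
    have h1 : a - b * α ≠ 0 := by
      intro h
      obtain ⟨rfl, hb0⟩ := coords_unique hα ha (neg_mem hb) (zero_mem F) (zero_mem F)
        (by linarith : a + -b * α = 0 + 0 * α)
      exact h0 (by simp [neg_eq_zero.1 hb0])
    have hN : a ^ 2 - b ^ 2 * α ^ 2 ∈ F :=
      sub_mem (pow_mem ha 2) (mul_mem (pow_mem hb 2) hα2)
    refine ⟨a / (a ^ 2 - b ^ 2 * α ^ 2), div_mem ha hN, -b / (a ^ 2 - b ^ 2 * α ^ 2),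
      div_mem (neg_mem hb) hN, ?_⟩
    have h2 : a ^ 2 - b ^ 2 * α ^ 2 = (a + b * α) * (a - b * α) := by ring
    rw [h2]
    field_simp
    ring

/-- The conjugation `a + b α ↦ a - b α` of a field contained in `F + F α`. -/
lemma exists_conj {F L : IntermediateField ℚ ℝ} {α : ℝ} (hα : α ∉ F) (hα2 : α ^ 2 ∈ F)
    (hL : ∀ x ∈ L, ∃ a ∈ F, ∃ b ∈ F, x = a + b * α) :
    ∃ σ : L →+* ℝ, ∀ (x : L) (a b : ℝ), a ∈ F → b ∈ F → (x : ℝ) = a + b * α →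
      σ x = a - b * α := by
  choose A hA B hB h using fun x : L => hL x x.2
  have key (x : L) (a b : ℝ) (ha : a ∈ F) (hb : b ∈ F) (hx : (x : ℝ) = a + b * α) :
      A x - B x * α = a - b * α := by
    obtain ⟨h1, h2⟩ := coords_unique hα (hA x) (hB x) ha hb ((h x).symm.trans hx)
    rw [h1, h2]
  refine ⟨⟨⟨⟨fun x => A x - B x * α, ?_⟩, ?_⟩, ?_, ?_⟩, key⟩
  · simpa using key 1 1 0 (one_mem F) (zero_mem F) (by simp)
  · intro x y
    refine (key (x * y) (A x * A y + B x * B y * α ^ 2) (A x * B y + B x * A y)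
      (add_mem (mul_mem (hA x) (hA y)) (mul_mem (mul_mem (hB x) (hB y)) hα2))
      (add_mem (mul_mem (hA x) (hB y)) (mul_mem (hB x) (hA y))) ?_).trans (by ring)
    rw [MulMemClass.coe_mul, h x, h y]
    ring
  · simpa using key 0 0 0 (zero_mem F) (zero_mem F) (by simp)
  · intro x y
    refine (key (x + y) (A x + A y) (B x + B y) (add_mem (hA x) (hA y))
      (add_mem (hB x) (hB y)) ?_).trans (by ring)
    rw [AddMemClass.coe_add, h x, h y]
    ring

lemma sqrt_mem_QF (d : ℕ) : √(d : ℝ) ∈ QF d :=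
  IntermediateField.subset_adjoin ℚ _ (Set.mem_singleton _)

lemma ratCast_mem (F : IntermediateField ℚ ℝ) (r : ℚ) : (r : ℝ) ∈ F :=
  F.algebraMap_mem r

lemma mem_bot_real {x : ℝ} : x ∈ (⊥ : IntermediateField ℚ ℝ) ↔ ∃ r : ℚ, x = r := by
  simp [IntermediateField.mem_bot, eq_comm]

lemma sqrt_notMem_bot {d : ℕ} (hd : ¬IsSquare d) : √(d : ℝ) ∉ (⊥ : IntermediateField ℚ ℝ) := by
  rw [mem_bot_real]
  rintro ⟨r, hr⟩
  exact (irrational_sqrt_natCast_iff.2 hd) ⟨r, hr.symm⟩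

lemma sqrt_sq_mem (F : IntermediateField ℚ ℝ) (d : ℕ) : √(d : ℝ) ^ 2 ∈ F := by
  rw [Real.sq_sqrt d.cast_nonneg]
  exact natCast_mem F d

lemma exists_coords_QF_bot {d : ℕ} (hd : ¬IsSquare d) {x : ℝ} (hx : x ∈ QF d) :
    ∃ a ∈ (⊥ : IntermediateField ℚ ℝ), ∃ b ∈ (⊥ : IntermediateField ℚ ℝ),
      x = a + b * √(d : ℝ) := by
  refine exists_coords_of_mem_adjoin (sqrt_notMem_bot hd) (sqrt_sq_mem _ d) ?_ hx
  rintro s rfl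
  exact ⟨0, zero_mem _, 1, one_mem _, by simp⟩

lemma exists_coords_QF {d : ℕ} (hd : ¬IsSquare d) {x : ℝ} (hx : x ∈ QF d) :
    ∃ r s : ℚ, x = r + s * √(d : ℝ) := by
  obtain ⟨a, ha, b, hb, rfl⟩ := exists_coords_QF_bot hd hx
  obtain ⟨r, rfl⟩ := mem_bot_real.1 ha
  obtain ⟨s, rfl⟩ := mem_bot_real.1 hb
  exact ⟨r, s, rfl⟩

/-- If a square root of an element of `F` lies in `F + F α`, then it lies in `F` or in `F α`. -/
lemma mem_or_mul_mem_of_sq_mem {F : IntermediateField ℚ ℝ} {α x : ℝ} (hα : α ∉ F)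
    (hα2 : α ^ 2 ∈ F) (hx : ∃ a ∈ F, ∃ b ∈ F, x = a + b * α) (hx2 : x ^ 2 ∈ F) :
    x ∈ F ∨ x * α ∈ F := by
  obtain ⟨a, ha, b, hb, rfl⟩ := hx
  obtain ⟨-, h⟩ := coords_unique hα (add_mem (pow_mem ha 2) (mul_mem (pow_mem hb 2) hα2))
    (mul_mem (mul_mem (ofNat_mem F 2) ha) hb) hx2 (zero_mem F)
    (by ring : a ^ 2 + b ^ 2 * α ^ 2 + 2 * a * b * α = (a + b * α) ^ 2 + 0 * α)
  rcases mul_eq_zero.1 h with h | h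
  · obtain rfl : a = 0 := by linarith
    right
    rw [show (0 + b * α) * α = b * α ^ 2 by ring]
    exact mul_mem hb hα2
  · subst h
    left
    simpa using ha

lemma sqrt_notMem_QF {n d : ℕ} (hd : ¬IsSquare d) (hn : ¬IsSquare n)
    (hnd : ¬IsSquare (n * d)) : √(n : ℝ) ∉ QF d := by
  intro h
  rcases mem_or_mul_mem_of_sq_mem (sqrt_notMem_bot hd) (sqrt_sq_mem _ d)
    (exists_coords_QF_bot hd h) (sqrt_sq_mem _ n) with h | h
  · exact sqrt_notMem_bot hn h
  · rw [← Real.sqrt_mul n.cast_nonneg, ← Nat.cast_mul] at h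
    exact sqrt_notMem_bot hnd h

lemma K2_comm (a b : ℕ) : K2 a b = K2 b a := by
  rw [K2, K2, Set.pair_comm]

lemma QF_le_K2_left (a b : ℕ) : QF a ≤ K2 a b :=
  IntermediateField.adjoin.mono _ _ _ (by simp)

lemma QF_le_K2_right (a b : ℕ) : QF b ≤ K2 a b :=
  IntermediateField.adjoin.mono _ _ _ (by simp)

lemma sqrt_left_mem_K2 (a b : ℕ) : √(a : ℝ) ∈ K2 a b := QF_le_K2_left a b (sqrt_mem_QF a)

lemma sqrt_right_mem_K2 (a b : ℕ) : √(b : ℝ) ∈ K2 a b := QF_le_K2_right a b (sqrt_mem_QF b)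

lemma QF_mul_le_K2 (a b : ℕ) : QF (a * b) ≤ K2 a b := by
  rw [QF, IntermediateField.adjoin_le_iff]
  rintro _ rfl
  rw [Nat.cast_mul, Real.sqrt_mul a.cast_nonneg]
  exact mul_mem (sqrt_left_mem_K2 a b) (sqrt_right_mem_K2 a b)

lemma exists_coords_K2 {a b : ℕ} (h : √(a : ℝ) ∉ QF b) {x : ℝ} (hx : x ∈ K2 a b) :
    ∃ c ∈ QF b, ∃ d ∈ QF b, x = c + d * √(a : ℝ) := by
  refine exists_coords_of_mem_adjoin h (sqrt_sq_mem _ a) ?_ hx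
  rintro s (rfl | rfl)
  · exact ⟨0, zero_mem _, 1, one_mem _, by simp⟩
  · exact ⟨_, sqrt_mem_QF b, 0, zero_mem _, by simp⟩

lemma Squarefree.not_isSquare_of_ne_one {d : ℕ} (hd : Squarefree d) (h1 : d ≠ 1) :
    ¬IsSquare d := by
  rintro ⟨k, rfl⟩
  have := Nat.isUnit_iff.1 (hd k dvd_rfl)
  simp [this] at h1

lemma exists_int_of_isIntegral_ratCast {r : ℚ} (h : IsIntegral ℤ (r : ℝ)) : ∃ n : ℤ, r = n := by
  have h' : IsIntegral ℤ r :=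
    (isIntegral_algHom_iff ((Algebra.ofId ℚ ℝ).restrictScalars ℤ)
      (algebraMap ℚ ℝ).injective).1 (by simpa [Algebra.ofId_apply] using h)
  obtain ⟨n, hn⟩ := IsIntegrallyClosed.isIntegral_iff.1 h'
  exact ⟨n, by simpa using hn.symm⟩

lemma exists_half_int_coords {d : ℕ} (hd : Squarefree d) (h1 : d ≠ 1) {t : ℝ}
    (ht : IsUnitValue (QF d) t) :
    ∃ x y : ℤ, t = (x + y * √(d : ℝ)) / 2 ∧ (x ^ 2 - d * y ^ 2 = 4 ∨ x ^ 2 - d * y ^ 2 = -4) := by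
  have hsq := hd.not_isSquare_of_ne_one h1
  have hd0 : (d : ℚ) ≠ 0 := Nat.cast_ne_zero.2 hd.ne_zero
  have htm := (isUnitValue_iff.1 ht).1
  obtain ⟨r, s, hrs⟩ := exists_coords_QF hsq htm
  obtain ⟨σ, hσ⟩ := exists_conj (sqrt_notMem_bot hsq) (sqrt_sq_mem _ d)
    (fun x hx => exists_coords_QF_bot hsq hx)
  have hσt := hσ ⟨t, htm⟩ r s (ratCast_mem _ r) (ratCast_mem _ s) hrs
  obtain ⟨hc0, hc, hc'⟩ := IsUnitValue.map (x := ⟨t, htm⟩) ht σ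
  obtain ⟨-, ht0, hi, hi'⟩ := isUnitValue_iff.1 ht
  rw [hσt] at hc0 hc hc'
  have hdd : √(d : ℝ) ^ 2 = d := Real.sq_sqrt d.cast_nonneg
  have hN : t * (r - s * √(d : ℝ)) = ((r ^ 2 - d * s ^ 2 : ℚ) : ℝ) := by
    rw [hrs]
    push_cast
    linear_combination -s ^ 2 * hdd
  obtain ⟨x, hx⟩ := exists_int_of_isIntegral_ratCast (r := 2 * r) (by
    have : ((2 * r : ℚ) : ℝ) = t + (r - s * √(d : ℝ)) := by rw [hrs]; push_cast; ring
    rw [this]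
    exact hi.add hc)
  obtain ⟨N, hN1⟩ := exists_int_of_isIntegral_ratCast (hN ▸ hi.mul hc)
  obtain ⟨M, hM1⟩ := exists_int_of_isIntegral_ratCast (r := (r ^ 2 - d * s ^ 2)⁻¹) (by
    rw [Rat.cast_inv, ← hN, mul_inv]
    exact hi'.mul hc')
  have hN0 : r ^ 2 - d * s ^ 2 ≠ 0 := by
    intro h
    rw [h, Rat.cast_zero] at hN
    exact mul_ne_zero ht0 hc0 hN
  have hNM : N * M = 1 := by
    have := mul_inv_cancel₀ hN0
    rw [hM1, hN1] at this
    exact_mod_cast this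
  obtain ⟨w, hw⟩ := exists_int_of_isIntegral_ratCast (r := d * (2 * s)) (by
    refine IsIntegral.of_pow two_pos ?_
    have : (((d * (2 * s) : ℚ) : ℝ)) ^ 2 = ((d * (x ^ 2 - 4 * N) : ℤ) : ℝ) := by
      have : (d * (2 * s) : ℚ) ^ 2 = d * (x ^ 2 - 4 * N) := by
        rw [← hx, ← hN1]
        ring
      exact_mod_cast this
    rw [this]
    exact isIntegral_algebraMap (R := ℤ) (A := ℝ))
  have hw2 : w ^ 2 = d * (x ^ 2 - 4 * N) := by
    have : (w : ℚ) ^ 2 = d * (x ^ 2 - 4 * N) := by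
      rw [← hx, ← hN1, ← hw]
      ring
    exact_mod_cast this
  obtain ⟨y, rfl⟩ : (d : ℤ) ∣ w :=
    ((Int.squarefree_natCast.2 hd).dvd_pow_iff_dvd two_ne_zero).1 ⟨_, hw2⟩
  have hy : 2 * s = y := by
    push_cast at hw
    exact mul_left_cancel₀ hd0 hw
  refine ⟨x, y, ?_, ?_⟩
  · have hx' : (2 * r : ℝ) = x := by exact_mod_cast hx
    have hy' : (2 * s : ℝ) = y := by exact_mod_cast hy
    rw [hrs, ← hx', ← hy']
    ring
  · have : x ^ 2 - d * y ^ 2 = 4 * N := by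
      have : (x : ℚ) ^ 2 - d * y ^ 2 = 4 * N := by
        rw [← hx, ← hy, ← hN1]
        ring
      exact_mod_cast this
    rcases Int.eq_one_or_neg_one_of_mul_eq_one hNM with rfl | rfl
    · exact Or.inl (by linarith)
    · exact Or.inr (by linarith)

lemma isIntegral_half_int {d : ℕ} {a b N : ℤ} (h : a ^ 2 - d * b ^ 2 = 4 * N) :
    IsIntegral ℤ ((a + b * √(d : ℝ)) / 2) := by
  refine ⟨.X ^ 2 - .C a * .X + .C N, by monicity!, ?_⟩
  have hdd : √(d : ℝ) ^ 2 = d := Real.sq_sqrt d.cast_nonneg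
  have h' : (a : ℝ) ^ 2 - d * b ^ 2 = 4 * N := by exact_mod_cast h
  simp only [Polynomial.eval₂_add, Polynomial.eval₂_sub, Polynomial.eval₂_pow,
    Polynomial.eval₂_X, Polynomial.eval₂_mul, Polynomial.eval₂_C]
  simp only [eq_intCast]
  linear_combination b ^ 2 / 4 * hdd - h' / 4

lemma isUnitValue_half_int {d : ℕ} {a b : ℤ}
    (h : a ^ 2 - d * b ^ 2 = 4 ∨ a ^ 2 - d * b ^ 2 = -4) :
    IsUnitValue (QF d) ((a + b * √(d : ℝ)) / 2) := by
  have hdd : √(d : ℝ) ^ 2 = d := Real.sq_sqrt d.cast_nonneg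
  obtain ⟨N, hN, hN'⟩ : ∃ N : ℤ, N * N = 1 ∧ a ^ 2 - d * b ^ 2 = 4 * N := by
    rcases h with h | h
    · exact ⟨1, by norm_num, by linarith⟩
    · exact ⟨-1, by norm_num, by linarith⟩
  have hNR : (N : ℝ) * N = 1 := by exact_mod_cast hN
  have hNR' : (a : ℝ) ^ 2 - d * b ^ 2 = 4 * N := by exact_mod_cast hN'
  have hinv : (a + b * √(d : ℝ)) / 2 * (((N * a : ℤ) + (-(N * b) : ℤ) * √(d : ℝ)) / 2) = 1 := by
    push_cast
    linear_combination hNR' * N / 4 - N * b ^ 2 / 4 * hdd + hNR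
  refine isUnitValue_iff.2 ⟨?_, left_ne_zero_of_mul_eq_one hinv, isIntegral_half_int hN', ?_⟩
  · exact div_mem (add_mem (intCast_mem _ a) (mul_mem (intCast_mem _ b) (sqrt_mem_QF d)))
      (ofNat_mem _ 2)
  · rw [← eq_inv_of_mul_eq_one_right hinv]
    refine isIntegral_half_int (N := N) ?_
    linear_combination hN' * (N * N) + 4 * N * hN

/-- Splitting of `n (n - 4) = d y²` for odd squarefree `d`. -/
lemma exists_factorization {d n m y : ℕ} (hd : Squarefree d) (hodd : Odd d)
    (hnm : n = m + 4) (hm : 0 < m) (h : n * m = d * y ^ 2) :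
    ∃ s t a b : ℕ, s * t = d ∧
      ((n = s * a ^ 2 ∧ m = t * b ^ 2) ∨ (n = 2 * (s * a ^ 2) ∧ m = 2 * (t * b ^ 2))) := by
  have hdvd4 {k : ℕ} (h1 : k ∣ n) (h2 : k ∣ m) : k ∣ 4 := by
    rw [hnm] at h1
    exact (Nat.dvd_add_right h2).1 h1
  have hcop : Nat.Coprime (n.gcd d) (m.gcd d) := by
    refine Nat.eq_one_of_dvd_coprimes ((Nat.coprime_two_left.2 hodd).pow_left 2) ?_ ?_
    · exact hdvd4 ((Nat.gcd_dvd_left _ _).trans (Nat.gcd_dvd_left _ _))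
        ((Nat.gcd_dvd_right _ _).trans (Nat.gcd_dvd_left _ _))
    · exact (Nat.gcd_dvd_left _ _).trans (Nat.gcd_dvd_right _ _)
  have hst : n.gcd d * m.gcd d = d := by
    apply Nat.dvd_antisymm
    · exact hcop.mul_dvd_of_dvd_of_dvd (Nat.gcd_dvd_right _ _) (Nat.gcd_dvd_right _ _)
    · have : d ∣ n * m := ⟨_, h⟩
      simpa [Nat.gcd_comm] using Nat.dvd_gcd_mul_gcd_iff_dvd_mul.2 this
  obtain ⟨n', hn'⟩ := Nat.gcd_dvd_left n d
  obtain ⟨m', hm'⟩ := Nat.gcd_dvd_left m d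
  set s := n.gcd d
  set t := m.gcd d
  have hsq : n' * m' = y ^ 2 := by
    have : d * (n' * m') = d * y ^ 2 := by
      rw [← h, ← hst]
      conv_rhs => rw [hn', hm']
      ring
    exact Nat.eq_of_mul_eq_mul_left (Nat.pos_of_ne_zero hd.ne_zero) this
  have hm'0 : 0 < m' := Nat.pos_of_ne_zero fun h0 => hm.ne' (by rw [hm', h0, mul_zero])
  have hg0 : 0 < n'.gcd m' := Nat.gcd_pos_of_pos_right _ hm'0
  obtain ⟨g, n₁, m₁, hg, hcop', h1, h2⟩ := Nat.exists_coprime' hg0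
  have hg4 : g ∣ 4 := hdvd4 ⟨s * n₁, by rw [hn', h1]; ring⟩ ⟨t * m₁, by rw [hm', h2]; ring⟩
  obtain ⟨z, rfl⟩ : g ∣ y := by
    refine (Nat.pow_dvd_pow_iff two_ne_zero).1 ⟨n₁ * m₁, ?_⟩
    rw [← hsq, h1, h2]
    ring
  have hsq' : n₁ * m₁ = z ^ 2 := by
    have : g ^ 2 * (n₁ * m₁) = g ^ 2 * z ^ 2 := by
      rw [← mul_pow, ← hsq, h1, h2]
      ring
    exact Nat.eq_of_mul_eq_mul_left (pow_pos hg 2) this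
  obtain ⟨a, rfl⟩ := exists_eq_pow_of_mul_eq_pow (Nat.isUnit_iff.2 hcop') hsq'
  obtain ⟨b, rfl⟩ := exists_eq_pow_of_mul_eq_pow (Nat.isUnit_iff.2 hcop'.symm)
    ((mul_comm _ _).trans hsq')
  have hcases : g = 1 ∨ g = 2 ∨ g = 4 := by
    have := Nat.le_of_dvd (by norm_num) hg4
    interval_cases g <;> simp_all
  rcases hcases with rfl | rfl | rfl
  · exact ⟨s, t, a, b, hst, Or.inl ⟨by rw [hn', h1]; ring, by rw [hm', h2]; ring⟩⟩
  · exact ⟨s, t, a, b, hst, Or.inr ⟨by rw [hn', h1]; ring, by rw [hm', h2]; ring⟩⟩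
  · exact ⟨s, t, 2 * a, 2 * b, hst, Or.inl ⟨by rw [hn', h1]; ring, by rw [hm', h2]; ring⟩⟩

lemma exists_sqrt_form {d : ℕ} (hd : Squarefree d) (hodd : Odd d) {x y : ℤ}
    (h : x ^ 2 - d * y ^ 2 = 4) (ht : 1 < (x + y * √(d : ℝ)) / 2) :
    ∃ s t a b : ℕ, s * t = d ∧
      ((s * a ^ 2 = t * b ^ 2 + 4 ∧
          4 * ((x + y * √(d : ℝ)) / 2) = (a * √(s : ℝ) + b * √(t : ℝ)) ^ 2) ∨
        (s * a ^ 2 = t * b ^ 2 + 2 ∧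
          2 * ((x + y * √(d : ℝ)) / 2) = (a * √(s : ℝ) + b * √(t : ℝ)) ^ 2)) := by
  have hdd : √(d : ℝ) ^ 2 = d := Real.sq_sqrt d.cast_nonneg
  have hd0 : 0 < √(d : ℝ) := Real.sqrt_pos.2 (Nat.cast_pos.2 (Nat.pos_of_ne_zero hd.ne_zero))
  have hR : (x : ℝ) ^ 2 - d * y ^ 2 = 4 := by exact_mod_cast h
  set T := (x + y * √(d : ℝ)) / 2 with hT
  set T' := (x - y * √(d : ℝ)) / 2 with hT'
  have hTT : T * T' = 1 := by
    rw [hT, hT']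
    linear_combination hR / 4 - y ^ 2 / 4 * hdd
  have hT'1 : T' < 1 := by
    by_contra! hc
    nlinarith
  have hT'0 : 0 < T' := by
    by_contra! hc
    nlinarith
  have hx : 2 < x := by
    have : (2 : ℝ) < x := by
      have : (x : ℝ) = T + T' := by rw [hT, hT']; ring
      rw [this]
      nlinarith [mul_pos (sub_pos.2 ht) (sub_pos.2 hT'1)]
    exact_mod_cast this
  have hy : 0 < y := by
    have : (0 : ℝ) < y * √(d : ℝ) := by
      have : y * √(d : ℝ) = T - T' := by rw [hT, hT']; ring
      linarith
    exact_mod_cast (pos_iff_pos_of_mul_pos this).2 hd0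
  obtain ⟨m, hm⟩ := Int.eq_ofNat_of_zero_le (by linarith : 0 ≤ x - 2)
  obtain ⟨z, rfl⟩ := Int.eq_ofNat_of_zero_le hy.le
  obtain rfl : x = m + 2 := by linarith
  have hmain : (m + 4) * m = d * z ^ 2 := by
    zify
    linear_combination h
  obtain ⟨s, t, a, b, rfl, hab⟩ := exists_factorization hd hodd rfl (by omega) hmain
  refine ⟨s, t, a, b, rfl, ?_⟩
  have hs : √(s : ℝ) ^ 2 = s := Real.sq_sqrt s.cast_nonneg
  have ht : √(t : ℝ) ^ 2 = t := Real.sq_sqrt t.cast_nonneg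
  have hst0 : 0 < s * t := Nat.pos_of_ne_zero hd.ne_zero
  have hmul : √((s * t : ℕ) : ℝ) = √(s : ℝ) * √(t : ℝ) := by
    rw [Nat.cast_mul, Real.sqrt_mul s.cast_nonneg]
  rcases hab with ⟨h1, h2⟩ | ⟨h1, h2⟩
  · left
    have hz : z = a * b := by
      have : s * t * z ^ 2 = s * t * (a * b) ^ 2 := by
        rw [← hmain, h1]
        conv_lhs => rw [h2]
        ring
      exact Nat.pow_left_injective two_ne_zero (Nat.eq_of_mul_eq_mul_left hst0 this)
    have h1' : (m : ℝ) + 4 = s * a ^ 2 := by exact_mod_cast h1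
    have h2' : (m : ℝ) = t * b ^ 2 := by exact_mod_cast h2
    refine ⟨by omega, ?_⟩
    rw [hT, hmul, hz]
    push_cast
    linear_combination h1' + h2' - a ^ 2 * hs - b ^ 2 * ht
  · right
    have hz : z = 2 * (a * b) := by
      have : s * t * z ^ 2 = s * t * (2 * (a * b)) ^ 2 := by
        rw [← hmain, h1]
        conv_lhs => rw [h2]
        ring
      exact Nat.pow_left_injective two_ne_zero (Nat.eq_of_mul_eq_mul_left hst0 this)
    have h1' : (m : ℝ) + 4 = 2 * (s * a ^ 2) := by exact_mod_cast h1
    have h2' : (m : ℝ) = 2 * (t * b ^ 2) := by exact_mod_cast h2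
    refine ⟨by omega, ?_⟩
    rw [hT, hmul, hz]
    push_cast
    linear_combination h1' / 2 + h2' / 2 - a ^ 2 * hs - b ^ 2 * ht

lemma IsFundUnit.one_lt {d : ℕ} {t : ℝ} (ht : IsFundUnit d t) : 1 < t := by
  obtain ⟨_, _, h, _⟩ := ht
  exact h

lemma IsFundUnit.isUnitValue {d : ℕ} {t : ℝ} (ht : IsFundUnit d t) : IsUnitValue (QF d) t := by
  obtain ⟨ε, h, _⟩ := ht
  exact ⟨ε, h⟩

lemma IsFundUnit.exists_zpow {d : ℕ} {t x : ℝ} (ht : IsFundUnit d t)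
    (hx : IsUnitValue (QF d) x) : ∃ n : ℤ, x = t ^ n ∨ x = -t ^ n := by
  obtain ⟨ε, rfl, _, h⟩ := ht
  obtain ⟨u, rfl⟩ := hx
  obtain ⟨n, rfl | rfl⟩ := h u
  · exact ⟨n, Or.inl (uval_zpow ε n)⟩
  · exact ⟨n, Or.inr (by rw [uval_neg, uval_zpow])⟩

lemma IsFundUnit.sq_ne {d : ℕ} {t x : ℝ} (ht : IsFundUnit d t)
    (hx : IsUnitValue (QF d) x) : x ^ 2 ≠ t := by
  intro h
  obtain ⟨n, hn⟩ := ht.exists_zpow hx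
  have hn2 : t ^ (n * 2) = t ^ (1 : ℤ) := by
    rw [zpow_mul, zpow_one, zpow_ofNat]
    refine Eq.trans ?_ h
    rcases hn with rfl | rfl <;> simp
  have := zpow_right_injective₀ (zero_lt_one.trans ht.one_lt) ht.one_lt.ne' hn2
  omega

lemma IsFundUnit.four_mul_ne_sq_of_norm_one {d a b : ℕ} {t : ℝ} (ht : IsFundUnit d t)
    (h : a ^ 2 = d * b ^ 2 + 4) : 4 * t ≠ (a + b * √(d : ℝ)) ^ 2 := by
  intro h4
  refine ht.sq_ne (isUnitValue_half_int (a := a) (b := b) (Or.inl ?_))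
    (by push_cast; linarith)
  zify at h
  linear_combination h

lemma IsFundUnit.four_mul_ne_sq_of_norm_neg_one {d a b : ℕ} {t : ℝ} (ht : IsFundUnit d t)
    (h : d * a ^ 2 = b ^ 2 + 4) : 4 * t ≠ (a * √(d : ℝ) + b) ^ 2 := by
  intro h4
  refine ht.sq_ne (isUnitValue_half_int (a := b) (b := a) (Or.inr ?_))
    (by push_cast; linarith)
  zify at h
  linear_combination -h

lemma isSquare_of_mul_sq_eq_sq {F : Type*} [Field F] {c a e : F} (he : e ≠ 0)
    (h : c * a ^ 2 = e ^ 2) : IsSquare c := by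
  have ha : a ≠ 0 := by
    rintro rfl
    exact pow_ne_zero 2 he (by rw [← h]; simp)
  exact ⟨e / a, by field_simp; exact h⟩

lemma ZMod.two_ne_zero_of_odd_prime {p : ℕ} [Fact p.Prime] (hp : p ≠ 2) : (2 : ZMod p) ≠ 0 :=
  Ring.two_ne_zero (by rwa [ZMod.ringChar_zmod_n])

/-- For a prime `p ≡ 5 (mod 8)` the fundamental unit of `ℚ(√p)` has norm `-1`. -/
lemma IsFundUnit.norm_neg_one {p : ℕ} [Fact p.Prime] (hp : p % 8 = 5) {t : ℝ}
    (ht : IsFundUnit p t) :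
    ∃ x y : ℤ, t = (x + y * √(p : ℝ)) / 2 ∧ x ^ 2 - p * y ^ 2 = -4 := by
  have hpp : p.Prime := Fact.out
  have hp2 : p ≠ 2 := by omega
  obtain ⟨x, y, hxy, h | h⟩ := exists_half_int_coords hpp.squarefree hpp.ne_one ht.isUnitValue
  swap
  · exact ⟨x, y, hxy, h⟩
  exfalso
  obtain ⟨s, r, a, b, hsr, hab⟩ := exists_sqrt_form hpp.squarefree
    (Nat.odd_iff.2 (by omega)) h (hxy ▸ ht.one_lt)
  rw [← hxy] at hab
  rcases (Nat.dvd_prime hpp).1 (Dvd.intro _ hsr) with rfl | rfl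
  · obtain rfl : r = p := by simpa using hsr
    rcases hab with ⟨h1, h2⟩ | ⟨h1, -⟩
    · exact ht.four_mul_ne_sq_of_norm_one (by simpa using h1) (by simpa using h2)
    · have h1' := congrArg (Nat.cast : ℕ → ZMod r) h1
      push_cast at h1'
      have : IsSquare (2 : ZMod r) := ⟨a, by simp at h1'; rw [← h1', sq]⟩
      rw [ZMod.exists_sq_eq_two_iff hp2] at this
      omega
  · obtain rfl : r = 1 := Nat.eq_of_mul_eq_mul_left hpp.pos (by simpa using hsr)
    rcases hab with ⟨h1, h2⟩ | ⟨h1, -⟩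
    · exact ht.four_mul_ne_sq_of_norm_neg_one (by simpa using h1) (by simpa using h2)
    · have h1' := congrArg (Nat.cast : ℕ → ZMod s) h1
      push_cast at h1'
      have : IsSquare (-2 : ZMod s) := ⟨b, by simp at h1'; linear_combination h1'⟩
      rw [ZMod.exists_sq_eq_neg_two_iff hp2] at this
      omega

/-- Divisibility of the radicand by a prime `q ≡ 3 (mod 4)` forces units to have norm `1`. -/
lemma not_norm_neg {d q : ℕ} [Fact q.Prime] (hq : q % 4 = 3) (hqd : q ∣ d) (x y : ℤ) :
    x ^ 2 - d * y ^ 2 ≠ -4 := by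
  intro h
  have hd : (d : ZMod q) = 0 := (ZMod.natCast_eq_zero_iff _ _).2 hqd
  have h' := congrArg (Int.cast : ℤ → ZMod q) h
  push_cast at h'
  rw [hd] at h'
  have h2 := ZMod.two_ne_zero_of_odd_prime (p := q) (by omega)
  have : IsSquare (-1 : ZMod q) := ⟨x / 2, by field_simp; linear_combination -h'⟩
  rw [ZMod.exists_sq_eq_neg_one_iff] at this
  exact this hq

lemma mul_sq_ne_sq_add_four {d q a b : ℕ} [Fact q.Prime] (hq : q % 4 = 3) (hqd : q ∣ d) :
    d * a ^ 2 ≠ b ^ 2 + 4 := by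
  intro h
  refine not_norm_neg hq hqd b a ?_
  zify at h
  linear_combination -h

lemma IsFundUnit.two_mul_eq_sq {d q : ℕ} [Fact q.Prime] (hd : Squarefree d) (hodd : Odd d)
    (hq : q % 4 = 3) (hqd : q ∣ d) {t : ℝ} (ht : IsFundUnit d t)
    (hex : ∀ s r a b : ℕ, s * r = d → s ≠ 1 → r ≠ 1 → s * a ^ 2 ≠ r * b ^ 2 + 4) :
    ∃ s r a b : ℕ, s * r = d ∧ 2 * t = (a * √(s : ℝ) + b * √(r : ℝ)) ^ 2 := by
  have h1 : d ≠ 1 := by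
    rintro rfl
    rw [Nat.dvd_one.1 hqd] at hq
    omega
  obtain ⟨x, y, hxy, h | h⟩ := exists_half_int_coords hd h1 ht.isUnitValue
  swap
  · exact absurd h (not_norm_neg hq hqd x y)
  obtain ⟨s, r, a, b, rfl, hab⟩ := exists_sqrt_form hd hodd h (hxy ▸ ht.one_lt)
  rw [← hxy] at hab
  rcases hab with ⟨h1, h2⟩ | ⟨-, h2⟩
  · exfalso
    rcases eq_or_ne s 1 with rfl | hs
    · rw [one_mul] at ht
      exact ht.four_mul_ne_sq_of_norm_one (by simpa using h1) (by simpa using h2)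
    · rcases eq_or_ne r 1 with rfl | hr
      · exact mul_sq_ne_sq_add_four hq hqd (by simpa using h1)
      · exact hex s r a b rfl hs hr h1
  · exact ⟨s, r, a, b, rfl, h2⟩

lemma IsFundUnit.two_mul_eq_sq_of_prime {q : ℕ} [Fact q.Prime] (hq : q % 4 = 3) {t : ℝ}
    (ht : IsFundUnit q t) : ∃ m ∈ QF q, 2 * t = m ^ 2 := by
  have hqp : q.Prime := Fact.out
  obtain ⟨s, r, a, b, hsr, h⟩ := ht.two_mul_eq_sq hqp.squarefree (Nat.odd_iff.2 (by omega)) hq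
    dvd_rfl fun s r a b hsr hs hr => by
      rcases (Nat.prime_mul_iff.1 (hsr ▸ hqp)) with h | h
      · exact absurd h.2 hr
      · exact absurd h.2 hs
  refine ⟨_, ?_, h⟩
  rcases (Nat.prime_mul_iff.1 (hsr ▸ hqp)) with ⟨-, rfl⟩ | ⟨-, rfl⟩
  · obtain rfl : s = q := by simpa using hsr
    simpa using add_mem (mul_mem (natCast_mem _ a) (sqrt_mem_QF s)) (natCast_mem _ b)
  · obtain rfl : r = q := by simpa using hsr
    simpa using add_mem (natCast_mem _ a) (mul_mem (natCast_mem _ b) (sqrt_mem_QF r))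

lemma sqrt_mem_K2_of_dvd {p q s : ℕ} (hp : p.Prime) (hq : q.Prime) (h : s ∣ p * q) :
    √(s : ℝ) ∈ K2 p q := by
  obtain ⟨s₁, s₂, h1, h2, rfl⟩ := (Nat.dvd_mul).1 h
  rw [Nat.cast_mul, Real.sqrt_mul s₁.cast_nonneg]
  refine mul_mem ?_ ?_
  · rcases (Nat.dvd_prime hp).1 h1 with rfl | rfl
    · simp [one_mem]
    · exact sqrt_left_mem_K2 _ _
  · rcases (Nat.dvd_prime hq).1 h2 with rfl | rfl
    · simp [one_mem]
    · exact sqrt_right_mem_K2 _ _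

lemma IsFundUnit.two_mul_eq_sq_of_mul {p q : ℕ} [Fact p.Prime] [Fact q.Prime] (hp : p % 4 = 1)
    (hq : q % 4 = 3) (hleg : legendreSym q p = -1) {t : ℝ} (ht : IsFundUnit (p * q) t) :
    ∃ m ∈ K2 p q, 2 * t = m ^ 2 := by
  have hpp : p.Prime := Fact.out
  have hqp : q.Prime := Fact.out
  have hne : p ≠ q := by rintro rfl; omega
  have hleg' : legendreSym p q = -1 := by
    rw [← legendreSym.quadratic_reciprocity_one_mod_four hp (by omega), hleg]
  have hpq : ¬IsSquare (p : ZMod q) := by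
    simpa using legendreSym.eq_neg_one_iff q |>.1 hleg
  have hqp' : ¬IsSquare (q : ZMod p) := by
    simpa using legendreSym.eq_neg_one_iff p |>.1 hleg'
  have hpo : Odd p := Nat.odd_iff.2 (by omega)
  have hqo : Odd q := Nat.odd_iff.2 (by omega)
  have hsf : Squarefree (p * q) := (Nat.squarefree_mul ((Nat.coprime_primes hpp hqp).2 hne)).2
    ⟨hpp.squarefree, hqp.squarefree⟩
  obtain ⟨s, r, a, b, hsr, h⟩ := ht.two_mul_eq_sq hsf (hpo.mul hqo) hq (Dvd.intro_left _ rfl) <| by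
    intro s r a b hsr hs hr h
    obtain ⟨s₁, s₂, h1, h2, rfl⟩ := Nat.dvd_mul.1 (Dvd.intro r hsr)
    rcases (Nat.dvd_prime hpp).1 h1 with rfl | rfl <;>
      rcases (Nat.dvd_prime hqp).1 h2 with rfl | rfl
    · simp at hs
    · obtain rfl : r = p := by
        refine Nat.eq_of_mul_eq_mul_left hqp.pos ?_
        linarith
      have h' := congrArg (Nat.cast : ℕ → ZMod r) h
      push_cast at h'
      refine hqp' (isSquare_of_mul_sq_eq_sq
        (ZMod.two_ne_zero_of_odd_prime (p := r) (by omega)) (a := (a : ZMod r)) ?_)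
      simp at h'
      linear_combination h'
    · obtain rfl : r = q := by
        refine Nat.eq_of_mul_eq_mul_left hpp.pos ?_
        linarith
      have h' := congrArg (Nat.cast : ℕ → ZMod r) h
      push_cast at h'
      refine hpq (isSquare_of_mul_sq_eq_sq
        (ZMod.two_ne_zero_of_odd_prime (p := r) (by omega)) (a := (a : ZMod r)) ?_)
      simp at h'
      linear_combination h'
    · refine hr (Nat.eq_of_mul_eq_mul_left (Nat.mul_pos hpp.pos hqp.pos) ?_)
      rw [hsr, mul_one]
  exact ⟨_, add_mem
    (mul_mem (natCast_mem _ a) (sqrt_mem_K2_of_dvd hpp hqp (Dvd.intro _ hsr)))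
    (mul_mem (natCast_mem _ b) (sqrt_mem_K2_of_dvd hpp hqp (Dvd.intro_left _ hsr))), h⟩

lemma IsUnitValue.mul {K : IntermediateField ℚ ℝ} {x y : ℝ} (hx : IsUnitValue K x)
    (hy : IsUnitValue K y) : IsUnitValue K (x * y) := by
  obtain ⟨u, rfl⟩ := hx
  obtain ⟨v, rfl⟩ := hy
  exact ⟨u * v, uval_mul u v⟩

lemma IsUnitValue.of_sq {K : IntermediateField ℚ ℝ} {x : ℝ} (hx : x ∈ K)
    (h : IsUnitValue K (x ^ 2)) : IsUnitValue K x := by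
  obtain ⟨-, h0, hi, hi'⟩ := isUnitValue_iff.1 h
  exact isUnitValue_iff.2 ⟨hx, fun h => h0 (by simp [h]), hi.of_pow two_pos,
    IsIntegral.of_pow two_pos (by rwa [inv_pow])⟩

/-- The square of a unit of `ℚ(√a, √b)` is a product of units of its quadratic subfields. -/
lemma sq_eq_mul_units {a b : ℕ} (hab : √(a : ℝ) ∉ QF b) (hba : √(b : ℝ) ∉ QF a)
    (hb : ¬IsSquare b) {u : ℝ} (hu : IsUnitValue (K2 a b) u) :
    ∃ e f g : ℝ, IsUnitValue (QF a) e ∧ IsUnitValue (QF b) f ∧ IsUnitValue (QF (a * b)) g ∧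
      u ^ 2 * g = e * f := by
  have hL := fun x (hx : x ∈ K2 a b) => exists_coords_K2 hab hx
  have hL' := fun x (hx : x ∈ K2 a b) => exists_coords_K2 hba (K2_comm a b ▸ hx)
  obtain ⟨σ, hσ⟩ := exists_conj hab (sqrt_sq_mem _ a) hL
  obtain ⟨τ, hτ⟩ := exists_conj hba (sqrt_sq_mem _ b) hL'
  obtain ⟨hum, hu0, hi, hi'⟩ := isUnitValue_iff.1 hu
  obtain ⟨A, hA, B, hB, huAB⟩ := hL u hum
  obtain ⟨x, z, rfl⟩ := exists_coords_QF hb hA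
  obtain ⟨y, w, rfl⟩ := exists_coords_QF hb hB
  set α := √(a : ℝ) with hα
  set β := √(b : ℝ) with hβ
  have hα2 : α ^ 2 = ((a : ℚ) : ℝ) := by rw [hα, Real.sq_sqrt a.cast_nonneg]; simp
  have hβ2 : β ^ 2 = ((b : ℚ) : ℝ) := by rw [hβ, Real.sq_sqrt b.cast_nonneg]; simp
  have hmem {d : ℕ} (r s : ℚ) : (r : ℝ) + s * √(d : ℝ) ∈ QF d :=
    add_mem (ratCast_mem _ r) (mul_mem (ratCast_mem _ s) (sqrt_mem_QF d))
  have hσu := hσ ⟨u, hum⟩ _ _ hA hB huAB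
  have hτu := hτ ⟨u, hum⟩ (x + y * α) (z + w * α) (hmem x y) (hmem z w)
    (huAB.trans (by ring))
  obtain ⟨hs0, hs, hs'⟩ := IsUnitValue.map (x := ⟨u, hum⟩) hu σ
  obtain ⟨ht0, ht, ht'⟩ := IsUnitValue.map (x := ⟨u, hum⟩) hu τ
  rw [hσu] at hs0 hs hs'
  rw [hτu] at ht0 ht ht'
  set S := x + z * β - (y + w * β) * α with hS
  set T := x + y * α - (z + w * α) * β with hT
  have hunit {K : IntermediateField ℚ ℝ} {v w : ℝ} (hm : v * w ∈ K) (hv0 : v ≠ 0) (hw0 : w ≠ 0)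
      (hv : IsIntegral ℤ v) (hw : IsIntegral ℤ w) (hv' : IsIntegral ℤ v⁻¹)
      (hw' : IsIntegral ℤ w⁻¹) : IsUnitValue K (v * w) :=
    isUnitValue_iff.2 ⟨hm, mul_ne_zero hv0 hw0, hv.mul hw, by rw [mul_inv]; exact hv'.mul hw'⟩
  refine ⟨u * T, u * S, S * T, hunit ?_ hu0 ht0 hi ht hi' ht', hunit ?_ hu0 hs0 hi hs hi' hs',
    hunit ?_ hs0 ht0 hs ht hs' ht', by ring⟩
  · have : u * T = ((x ^ 2 + a * y ^ 2 - b * (z ^ 2 + a * w ^ 2) : ℚ) : ℝ) +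
        ((2 * (x * y - b * z * w) : ℚ) : ℝ) * α := by
      rw [huAB, hT]
      push_cast at hα2 hβ2 ⊢
      linear_combination (y ^ 2 - w ^ 2 * β ^ 2) * hα2 -
        (z ^ 2 + 2 * z * w * α + a * w ^ 2) * hβ2
    rw [this]
    exact hmem _ _
  · have : u * S = ((x ^ 2 + b * z ^ 2 - a * (y ^ 2 + b * w ^ 2) : ℚ) : ℝ) +
        ((2 * (x * z - a * y * w) : ℚ) : ℝ) * β := by
      rw [huAB, hS]
      push_cast at hα2 hβ2 ⊢
      linear_combination (z ^ 2 - w ^ 2 * α ^ 2) * hβ2 -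
        (y ^ 2 + 2 * y * w * β + b * w ^ 2) * hα2
    rw [this]
    exact hmem _ _
  · have : S * T = ((x ^ 2 + a * b * w ^ 2 - a * y ^ 2 - b * z ^ 2 : ℚ) : ℝ) +
        ((2 * (y * z - x * w) : ℚ) : ℝ) * √((a * b : ℕ) : ℝ) := by
      rw [Nat.cast_mul, Real.sqrt_mul a.cast_nonneg, ← hα, ← hβ, hS, hT]
      push_cast at hα2 hβ2 ⊢
      linear_combination (w ^ 2 * β ^ 2 - y ^ 2) * hα2 + (w ^ 2 * a - z ^ 2) * hβ2
    rw [this]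
    exact hmem _ _

lemma not_isSquare_mul_of_not_dvd {r n : ℕ} (hr : r.Prime) (hn : ¬r ∣ n) :
    ¬IsSquare (r * n) := by
  rintro ⟨k, hk⟩
  obtain ⟨j, rfl⟩ : r ∣ k := (hr.dvd_mul.1 (Dvd.intro _ hk)).elim id id
  refine hn ⟨j * j, Nat.eq_of_mul_eq_mul_left hr.pos ?_⟩
  rw [hk]
  ring

lemma not_isSquare_mul_primes {p q : ℕ} (hp : p.Prime) (hq : q.Prime) (h : p ≠ q) :
    ¬IsSquare (p * q) :=
  not_isSquare_mul_of_not_dvd hp fun hd => h ((Nat.prime_dvd_prime_iff_eq hp hq).1 hd)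

lemma sqrt_notMem_QF_of_primes {p q : ℕ} (hp : p.Prime) (hq : q.Prime) (h : p ≠ q) :
    √(p : ℝ) ∉ QF q :=
  sqrt_notMem_QF hq.prime.not_isSquare hp.prime.not_isSquare (not_isSquare_mul_primes hp hq h)

lemma sqrt_two_notMem_K2 {p q : ℕ} (hp : p.Prime) (hq : q.Prime) (hp2 : p ≠ 2) (hq2 : q ≠ 2)
    (h : p ≠ q) : √(2 : ℝ) ∉ K2 p q := by
  intro h2
  have hroot := sqrt_notMem_QF_of_primes hp hq h
  have hsq2 : √(2 : ℝ) ^ 2 ∈ QF q := by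
    rw [Real.sq_sqrt zero_le_two]
    exact ofNat_mem _ 2
  rcases mem_or_mul_mem_of_sq_mem hroot (sqrt_sq_mem _ p) (exists_coords_K2 hroot h2) hsq2
    with h' | h'
  · exact sqrt_notMem_QF_of_primes Nat.prime_two hq hq2.symm (by simpa using h')
  · rw [← Real.sqrt_mul zero_le_two] at h'
    refine sqrt_notMem_QF (n := 2 * p) hq.prime.not_isSquare
      (not_isSquare_mul_primes Nat.prime_two hp hp2.symm) ?_ (by simpa using h')
    rw [mul_assoc]
    refine not_isSquare_mul_of_not_dvd Nat.prime_two fun hd => ?_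
    rcases Nat.prime_two.dvd_mul.1 hd with hd | hd
    · exact hp2 ((Nat.prime_dvd_prime_iff_eq Nat.prime_two hp).1 hd).symm
    · exact hq2 ((Nat.prime_dvd_prime_iff_eq Nat.prime_two hq).1 hd).symm

/-- If `ε_p ^ a ε_q ^ b` is the square of a unit of `ℚ(√p, √q)`, then `a` and `b` are even. -/
lemma even_exponents {p q : ℕ} [Fact p.Prime] [Fact q.Prime] (hp : p % 8 = 5) (hq : q % 8 = 3)
    {s t v : ℝ} (hs : IsFundUnit p s) (ht : IsFundUnit q t) (hv : IsUnitValue (K2 p q) v)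
    {a b : ℤ} (h : v ^ 2 = s ^ a * t ^ b) : Even a ∧ Even b := by
  have hpp : p.Prime := Fact.out
  have hqp : q.Prime := Fact.out
  have hpq : p ≠ q := by rintro rfl; omega
  have hs0 : 0 < s := zero_lt_one.trans hs.one_lt
  have ht0 : 0 < t := zero_lt_one.trans ht.one_lt
  have hvK := (isUnitValue_iff.1 hv).1
  have hsK := QF_le_K2_left p q (isUnitValue_iff.1 hs.isUnitValue).1
  have htq := (isUnitValue_iff.1 ht.isUnitValue).1
  have htK := QF_le_K2_right p q htq
  have ha : Even a := by
    have hroot := sqrt_notMem_QF_of_primes hpp hqp hpq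
    obtain ⟨σ, hσ⟩ := exists_conj hroot (sqrt_sq_mem _ p) fun x hx => exists_coords_K2 hroot hx
    obtain ⟨x, y, hxy, hN⟩ := hs.norm_neg_one hp
    have hhalf (z : ℤ) : (z / 2 : ℝ) ∈ QF q := div_mem (intCast_mem _ z) (ofNat_mem _ 2)
    have hσs := hσ ⟨s, hsK⟩ (x / 2) (y / 2) (hhalf x) (hhalf y) (hxy.trans (by ring))
    have hσt := hσ ⟨t, htK⟩ t 0 htq (zero_mem _) (by simp)
    rw [zero_mul, sub_zero] at hσt
    have hneg : σ ⟨s, hsK⟩ < 0 := by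
      have hN' : (x : ℝ) ^ 2 - p * y ^ 2 = -4 := by exact_mod_cast hN
      have hprod : s * σ ⟨s, hsK⟩ = -1 := by
        have hsp : √(p : ℝ) ^ 2 = p := Real.sq_sqrt p.cast_nonneg
        rw [hσs, hxy]
        linear_combination hN' / 4 - y ^ 2 / 4 * hsp
      by_contra! hc
      nlinarith
    have hσv : σ ⟨v, hvK⟩ ^ 2 = σ ⟨s, hsK⟩ ^ a * t ^ b := by
      rw [← hσt, ← map_pow, ← map_zpow₀, ← map_zpow₀, ← map_mul]
      refine congrArg σ ((K2 p q).val.injective ?_)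
      rw [map_pow, map_mul, map_zpow₀, map_zpow₀]
      exact h
    by_contra hodd
    have h1 := mul_neg_of_neg_of_pos ((Int.not_even_iff_odd.1 hodd).zpow_neg hneg)
      (zpow_pos ht0 b)
    rw [← hσv] at h1
    exact absurd (sq_nonneg _) h1.not_ge
  refine ⟨ha, ?_⟩
  by_contra hodd
  obtain ⟨a', rfl⟩ := ha
  obtain ⟨b', rfl⟩ := Int.not_even_iff_odd.1 hodd
  obtain ⟨m, hm, hm2⟩ := ht.two_mul_eq_sq_of_prime (by omega)
  have hv0 := (isUnitValue_iff.1 hv).2.1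
  refine sqrt_two_notMem_K2 hpp hqp (by omega) (by omega) hpq ?_
  have h2 : (2 : ℝ) = (m * s ^ a' * t ^ b' / v) ^ 2 := by
    rw [zpow_add₀ hs0.ne', zpow_add_one₀ ht0.ne', two_mul, zpow_add₀ ht0.ne'] at h
    rw [div_pow, mul_pow, mul_pow, ← hm2, eq_div_iff (pow_ne_zero 2 hv0), h]
    ring
  rw [h2, Real.sqrt_sq_eq_abs]
  have hmem : m * s ^ a' * t ^ b' / v ∈ K2 p q :=
    div_mem (mul_mem (mul_mem (QF_le_K2_right p q hm) (zpow_mem hsK _)) (zpow_mem htK _)) hvK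
  rcases abs_choice (m * s ^ a' * t ^ b' / v) with h | h <;> rw [h]
  · exact hmem
  · exact neg_mem hmem

theorem fsu_Qsqrtp_sqrtq_legendre_neg_one
    (p q : ℕ) [Fact (Nat.Prime p)] [Fact (Nat.Prime q)]
    (hp : p % 8 = 5) (hq : q % 8 = 3) (hleg : legendreSym q (p : ℤ) = -1)
    (ep eq' epq : ℝ)
    (hep : IsFundUnit p ep) (heq : IsFundUnit q eq')
    (hepq : IsFundUnit (p * q) epq) :
    (∃ Ep : (integralClosure ℤ (K2 p q))ˣ, uval Ep = ep) ∧
    (∃ Eq' : (integralClosure ℤ (K2 p q))ˣ, uval Eq' = eq') ∧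
    (∃ U : (integralClosure ℤ (K2 p q))ˣ, uval U ^ 2 = eq' * epq) ∧
    ∀ Ep Eq' U : (integralClosure ℤ (K2 p q))ˣ,
      uval Ep = ep → uval Eq' = eq' → uval U ^ 2 = eq' * epq →
      Subgroup.closure {(-1 : (integralClosure ℤ (K2 p q))ˣ), Ep, Eq', U} = ⊤ := by
  have hpp : p.Prime := Fact.out
  have hqp : q.Prime := Fact.out
  have hpq : p ≠ q := by rintro rfl; omega
  have hroot := sqrt_notMem_QF_of_primes hpp hqp hpq
  have hroot' := sqrt_notMem_QF_of_primes hqp hpp hpq.symm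
  have hepK := hep.isUnitValue.mono (QF_le_K2_left p q)
  have heqK := heq.isUnitValue.mono (QF_le_K2_right p q)
  have hepqK := hepq.isUnitValue.mono (QF_mul_le_K2 p q)
  have hep0 : 0 < ep := zero_lt_one.trans hep.one_lt
  have heq0 : 0 < eq' := zero_lt_one.trans heq.one_lt
  have hepq0 : 0 < epq := zero_lt_one.trans hepq.one_lt
  obtain ⟨m, hm, hm2⟩ := heq.two_mul_eq_sq_of_prime (by omega)
  obtain ⟨k, hk, hk2⟩ := hepq.two_mul_eq_sq_of_mul (by omega) (by omega) hleg
  refine ⟨hepK, heqK, ?_, ?_⟩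
  · have hU2 : (m * k / 2) ^ 2 = eq' * epq := by
      linear_combination -(k ^ 2 / 4) * hm2 - eq' / 2 * hk2
    obtain ⟨U, hU⟩ : IsUnitValue (K2 p q) (m * k / 2) :=
      .of_sq (div_mem (mul_mem (QF_le_K2_right p q hm) hk) (ofNat_mem _ 2))
        (hU2 ▸ heqK.mul hepqK)
    exact ⟨U, by rw [hU, hU2]⟩
  rintro Ep Eq' U rfl rfl hU
  rw [eq_top_iff]
  rintro w -
  obtain ⟨e, f, g, he, hf, hg, hefg⟩ := sq_eq_mul_units hroot hroot' hqp.prime.not_isSquare ⟨w, rfl⟩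
  obtain ⟨a, ha⟩ := hep.exists_zpow he
  obtain ⟨b, hb⟩ := heq.exists_zpow hf
  obtain ⟨c, hc⟩ := hepq.exists_zpow hg
  have habs : uval w ^ 2 * epq ^ c = uval Ep ^ a * uval Eq' ^ b := by
    have h := congrArg abs hefg
    have habs_of {x y : ℝ} {n : ℤ} (hy : 0 < y) (h : x = y ^ n ∨ x = -y ^ n) : |x| = y ^ n := by
      rcases h with rfl | rfl <;> simp [abs_of_pos, zpow_pos hy]
    rwa [abs_mul, abs_mul, habs_of hep0 ha, habs_of heq0 hb, habs_of hepq0 hc, abs_sq] at h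
  have hv : uval (w * U ^ c) ^ 2 = uval Ep ^ a * uval Eq' ^ (b + c) := by
    rw [uval_mul, uval_zpow, mul_pow, ← zpow_natCast, ← zpow_natCast, zpow_comm,
      zpow_natCast, zpow_natCast, hU, mul_zpow, zpow_add₀ heq0.ne']
    linear_combination uval Eq' ^ c * habs
  obtain ⟨⟨a', rfl⟩, ⟨b', hb'⟩⟩ := even_exponents hp hq hep heq ⟨_, rfl⟩ hv
  have hsq : uval (w * U ^ c) ^ 2 = uval (Ep ^ a' * Eq' ^ b') ^ 2 := by
    rw [hv, hb', uval_mul, uval_zpow, uval_zpow, zpow_add₀ hep0.ne', zpow_add₀ heq0.ne']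
    ring
  have hgen {x : (integralClosure ℤ (K2 p q))ˣ} (hx : x ∈ ({-1, Ep, Eq', U} : Set _)) :
      x ∈ Subgroup.closure {(-1 : (integralClosure ℤ (K2 p q))ˣ), Ep, Eq', U} :=
    Subgroup.subset_closure hx
  have hprod : Ep ^ a' * Eq' ^ b' * (U ^ c)⁻¹ ∈
      Subgroup.closure {(-1 : (integralClosure ℤ (K2 p q))ˣ), Ep, Eq', U} :=
    mul_mem (mul_mem (zpow_mem (hgen (by simp)) _) (zpow_mem (hgen (by simp)) _))
      (inv_mem (zpow_mem (hgen (by simp)) _))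
  rcases sq_eq_sq_iff_eq_or_eq_neg.1 hsq with h | h
  · rw [eq_mul_inv_of_mul_eq (uval_injective h)]
    exact hprod
  · rw [← uval_neg] at h
    rw [eq_mul_inv_of_mul_eq (uval_injective h), neg_mul]
    simpa only [neg_one_mul] using mul_mem (hgen (x := -1) (by simp)) hprod
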